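/- The following three statements are equivalent: (A) Σ²(t) → 0 as t → ∞ (along real t); (B) Σ²(n) → 0 as n → ∞ (along integers n); (C) θ(n)²·log n → 0 as n → ∞. Moreover each of them implies that S'(ε) < +∞ for every ε > 0. -/

import Mathlib

/-- `theta σ n ≥ 0` with `(theta σ n)^2 = ∫_n^{n+1} σ(s)^2 ds`. -/
noncomputable def theta (σ : ℝ → ℝ) (n : ℕ) : ℝ :=
  Real.sqrt (∫ s in (n : ℝ)..((n : ℝ) + 1), (σ s) ^ 2)

/-- `Σ²(t) = (∫_0^t e^{−2(t−s)} σ(s)² ds)·log t`. -/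
noncomputable def Sig2 (σ : ℝ → ℝ) (t : ℝ) : ℝ :=
  (∫ s in (0 : ℝ)..t, Real.exp (-2 * (t - s)) * (σ s) ^ 2) * Real.log t

open Filter Topology intervalIntegral Set

/-- A nonnegative sequence that contracts by a factor `1/2` up to a null error is null. -/
lemma tendsto_zero_of_le_half_mul_add {a b : ℕ → ℝ} (ha : ∀ n, 0 ≤ a n)
    (hab : ∀ᶠ n in atTop, a (n + 1) ≤ 1 / 2 * a n + b n) (hb : Tendsto b atTop (𝓝 0)) :
    Tendsto a atTop (𝓝 0) := by
  refine tendsto_order.2 ⟨fun c hc => .of_forall fun n => hc.trans_le (ha n), fun c hc => ?_⟩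
  obtain ⟨N, hN⟩ := eventually_atTop.1 (hab.and (hb.eventually_le_const (by linarith : 0 < c / 4)))
  have key (k : ℕ) : a (N + k) ≤ (1 / 2 : ℝ) ^ k * a N + c / 2 := by
    induction k with
    | zero => simp; linarith
    | succ k ih =>
      obtain ⟨h1, h2⟩ := hN (N + k) (by omega)
      rw [← add_assoc, pow_succ]
      linarith
  have hlim : Tendsto (fun k : ℕ => (1 / 2 : ℝ) ^ k * a N) atTop (𝓝 0) := by
    simpa using (tendsto_pow_atTop_nhds_zero_of_lt_one (by norm_num : (0 : ℝ) ≤ 1 / 2)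
      (by norm_num)).mul_const (a N)
  obtain ⟨K, hK⟩ := eventually_atTop.1 (hlim.eventually_lt_const (half_pos hc))
  filter_upwards [eventually_ge_atTop (N + K)] with n hn
  obtain ⟨k, rfl⟩ := Nat.exists_eq_add_of_le (show N ≤ n by omega)
  linarith [key k, hK k (by omega)]

section

variable {σ : ℝ → ℝ}

lemma intervalIntegrable_mul_sq (hσ : ContinuousOn σ (Ici 0)) {f : ℝ → ℝ} (hf : Continuous f)
    {a b : ℝ} (ha : 0 ≤ a) (hb : 0 ≤ b) :
    IntervalIntegrable (fun s => f s * σ s ^ 2) MeasureTheory.volume a b :=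
  ((hf.continuousOn.mul (hσ.pow 2)).mono fun _ hx =>
    (le_min ha hb).trans hx.1).intervalIntegrable

lemma integral_mul_sq_le (hσ : ContinuousOn σ (Ici 0)) {f g : ℝ → ℝ} (hf : Continuous f)
    (hg : Continuous g) {a b : ℝ} (ha : 0 ≤ a) (hab : a ≤ b)
    (hfg : ∀ s ∈ Icc a b, f s ≤ g s) :
    ∫ s in a..b, f s * σ s ^ 2 ≤ ∫ s in a..b, g s * σ s ^ 2 :=
  integral_mono_on hab (intervalIntegrable_mul_sq hσ hf ha (ha.trans hab))
    (intervalIntegrable_mul_sq hσ hg ha (ha.trans hab))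
    fun s hs => mul_le_mul_of_nonneg_right (hfg s hs) (sq_nonneg _)

lemma theta_sq (σ : ℝ → ℝ) (n : ℕ) :
    theta σ n ^ 2 = ∫ s in (n : ℝ)..((n : ℝ) + 1), σ s ^ 2 :=
  Real.sq_sqrt (integral_nonneg (by linarith) fun _ _ => sq_nonneg _)

/-- The exponentially weighted integral of `σ²`. -/
noncomputable def weightedInt (σ : ℝ → ℝ) (t : ℝ) : ℝ :=
  ∫ s in (0 : ℝ)..t, Real.exp (-2 * (t - s)) * (σ s) ^ 2

lemma Sig2_eq (σ : ℝ → ℝ) (t : ℝ) : Sig2 σ t = weightedInt σ t * Real.log t := rfl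

lemma weightedInt_nonneg {t : ℝ} (ht : 0 ≤ t) : 0 ≤ weightedInt σ t :=
  integral_nonneg ht fun _ _ => by positivity

lemma weightedInt_split (hσ : ContinuousOn σ (Ici 0)) {a b : ℝ} (ha : 0 ≤ a) (hab : a ≤ b) :
    weightedInt σ b = Real.exp (-2 * (b - a)) * weightedInt σ a +
      ∫ s in a..b, Real.exp (-2 * (b - s)) * σ s ^ 2 := by
  have hc : Continuous fun s => Real.exp (-2 * (b - s)) := by fun_prop
  rw [weightedInt, weightedInt, ← integral_const_mul,
    ← integral_add_adjacent_intervals (intervalIntegrable_mul_sq hσ hc le_rfl ha)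
      (intervalIntegrable_mul_sq hσ hc ha (ha.trans hab))]
  congr 1
  refine integral_congr fun s _ => ?_
  rw [← mul_assoc, ← Real.exp_add]
  ring_nf

lemma weightedInt_le_exp_mul (hσ : ContinuousOn σ (Ici 0)) {a b : ℝ} (ha : 0 ≤ a) (hab : a ≤ b)
    (hb : b ≤ a + 1) : weightedInt σ a ≤ Real.exp 2 * weightedInt σ b := by
  have h0 : 0 ≤ ∫ s in a..b, Real.exp (-2 * (b - s)) * σ s ^ 2 :=
    integral_nonneg hab fun _ _ => by positivity
  have h1 : Real.exp (-2 * (b - a)) * weightedInt σ a ≤ weightedInt σ b := by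
    rw [weightedInt_split hσ ha hab]; linarith
  have h2 : 1 ≤ Real.exp 2 * Real.exp (-2 * (b - a)) := by
    rw [← Real.exp_add]; exact Real.one_le_exp (by linarith)
  calc weightedInt σ a ≤ Real.exp 2 * Real.exp (-2 * (b - a)) * weightedInt σ a :=
        le_mul_of_one_le_left (weightedInt_nonneg ha) h2
    _ ≤ _ := by rw [mul_assoc]; gcongr

lemma theta_sq_le_exp_mul (hσ : ContinuousOn σ (Ici 0)) (n : ℕ) :
    theta σ n ^ 2 ≤ Real.exp 2 * weightedInt σ (n + 1 : ℕ) := by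
  have hn : (0 : ℝ) ≤ n := n.cast_nonneg
  have h := integral_mul_sq_le (f := fun _ => Real.exp (-2))
    (g := fun s => Real.exp (-2 * ((n : ℝ) + 1 - s))) hσ (by fun_prop) (by fun_prop) hn
    (by linarith : (n : ℝ) ≤ n + 1) fun s hs => Real.exp_le_exp.2 (by linarith [hs.1])
  rw [integral_const_mul, ← theta_sq] at h
  have h1 : Real.exp (-2) * theta σ n ^ 2 ≤ weightedInt σ (n + 1 : ℕ) := by
    push_cast
    rw [weightedInt_split hσ hn (by linarith : (n : ℝ) ≤ n + 1)]
    have := mul_nonneg (Real.exp_nonneg (-2 * ((n : ℝ) + 1 - n))) (weightedInt_nonneg (σ := σ) hn)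
    linarith
  calc theta σ n ^ 2 = Real.exp 2 * (Real.exp (-2) * theta σ n ^ 2) := by
        rw [← mul_assoc, ← Real.exp_add]; simp
    _ ≤ _ := by gcongr

lemma weightedInt_succ_le (hσ : ContinuousOn σ (Ici 0)) (n : ℕ) :
    weightedInt σ (n + 1 : ℕ) ≤ Real.exp (-2) * weightedInt σ n + theta σ n ^ 2 := by
  have hn : (0 : ℝ) ≤ n := n.cast_nonneg
  have h := integral_mul_sq_le (f := fun s => Real.exp (-2 * ((n : ℝ) + 1 - s)))
    (g := fun _ => 1) hσ (by fun_prop) (by fun_prop) hn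
    (by linarith : (n : ℝ) ≤ n + 1) fun s hs => Real.exp_le_one_iff.2 (by linarith [hs.2])
  simp only [one_mul] at h
  rw [← theta_sq] at h
  push_cast
  rw [weightedInt_split hσ hn (by linarith : (n : ℝ) ≤ n + 1), add_sub_cancel_left, mul_one]
  linarith

lemma tendsto_Sig2_of_nat (hσ : ContinuousOn σ (Ici 0))
    (h : Tendsto (fun n : ℕ => Sig2 σ n) atTop (𝓝 0)) : Tendsto (Sig2 σ) atTop (𝓝 0) := by
  have hlim : Tendsto (fun t : ℝ => Real.exp 2 * Sig2 σ (⌊t⌋₊ + 1 : ℕ)) atTop (𝓝 0) := by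
    simpa using (h.comp ((tendsto_add_atTop_nat 1).comp tendsto_nat_floor_atTop)).const_mul
      (Real.exp 2)
  refine squeeze_zero' ?_ ?_ hlim
  · filter_upwards [eventually_ge_atTop 1] with t ht
    exact mul_nonneg (weightedInt_nonneg (by linarith)) (Real.log_nonneg ht)
  · filter_upwards [eventually_ge_atTop 1] with t ht
    have h1 : t ≤ (⌊t⌋₊ + 1 : ℕ) := by push_cast; exact (Nat.lt_floor_add_one t).le
    have h2 : ((⌊t⌋₊ + 1 : ℕ) : ℝ) ≤ t + 1 := by
      push_cast; linarith [Nat.floor_le (by linarith : 0 ≤ t)]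
    rw [Sig2_eq, Sig2_eq, ← mul_assoc]
    exact mul_le_mul (weightedInt_le_exp_mul hσ (by linarith) h1 h2)
      (Real.log_le_log (by linarith) h1) (Real.log_nonneg ht)
      (mul_nonneg (Real.exp_nonneg _) (weightedInt_nonneg (by linarith)))

lemma tendsto_theta_sq_mul_log (hσ : ContinuousOn σ (Ici 0))
    (h : Tendsto (fun n : ℕ => Sig2 σ n) atTop (𝓝 0)) :
    Tendsto (fun n : ℕ => theta σ n ^ 2 * Real.log n) atTop (𝓝 0) := by
  have hlim : Tendsto (fun n : ℕ => Real.exp 2 * Sig2 σ (n + 1 : ℕ)) atTop (𝓝 0) := by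
    simpa using (h.comp (tendsto_add_atTop_nat 1)).const_mul (Real.exp 2)
  refine squeeze_zero' (.of_forall fun n => mul_nonneg (sq_nonneg _) (Real.log_natCast_nonneg n))
    ?_ hlim
  filter_upwards [eventually_ge_atTop 1] with n hn
  rw [Sig2_eq, ← mul_assoc]
  have h0 : (0 : ℝ) < n := by exact_mod_cast hn
  exact mul_le_mul (theta_sq_le_exp_mul hσ n) (Real.log_le_log h0 (by push_cast; linarith))
    (Real.log_natCast_nonneg n)
    (mul_nonneg (Real.exp_nonneg _) (weightedInt_nonneg (Nat.cast_nonneg _)))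

lemma tendsto_Sig2_nat_of_theta (hσ : ContinuousOn σ (Ici 0))
    (h : Tendsto (fun n : ℕ => theta σ n ^ 2 * Real.log n) atTop (𝓝 0)) :
    Tendsto (fun n : ℕ => Sig2 σ n) atTop (𝓝 0) := by
  refine tendsto_zero_of_le_half_mul_add (b := fun n => 2 * (theta σ n ^ 2 * Real.log n))
    (fun n => mul_nonneg (weightedInt_nonneg n.cast_nonneg) (Real.log_natCast_nonneg n)) ?_
    (by simpa using h.const_mul 2)
  filter_upwards [eventually_ge_atTop 2] with n hn
  have hn2 : (2 : ℝ) ≤ n := by exact_mod_cast hn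
  have hlog : Real.log (n + 1 : ℕ) ≤ 2 * Real.log n := by
    rw [← Real.log_rpow (by linarith)]
    refine Real.log_le_log (by positivity) ?_
    norm_num
    nlinarith
  have hexp : Real.exp (-2) ≤ 1 / 4 := by
    have h1 : (2 : ℝ) ≤ Real.exp 1 := by linarith [Real.add_one_le_exp (1 : ℝ)]
    have h2 : Real.exp 2 = Real.exp 1 * Real.exp 1 := by rw [← Real.exp_add]; norm_num
    rw [Real.exp_neg, ← one_div]
    exact one_div_le_one_div_of_le (by norm_num) (by nlinarith)
  have hI := weightedInt_nonneg (σ := σ) n.cast_nonneg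
  have hl := Real.log_natCast_nonneg n
  rw [Sig2_eq, Sig2_eq]
  calc weightedInt σ (n + 1 : ℕ) * Real.log (n + 1 : ℕ)
      ≤ (1 / 4 * weightedInt σ n + theta σ n ^ 2) * (2 * Real.log n) := by
        refine mul_le_mul ((weightedInt_succ_le hσ n).trans ?_) hlog
          (Real.log_natCast_nonneg _) (by positivity)
        gcongr
    _ = _ := by ring

end

/-- If `θ(n)² log n → 0`, then the Gaussian-tail series of `θ` converges for every `ε`. -/
lemma summable_mul_exp_of_tendsto {θ : ℕ → ℝ} (hθ : ∀ n, 0 ≤ θ n)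
    (h : Tendsto (fun n : ℕ => θ n ^ 2 * Real.log n) atTop (𝓝 0)) {ε : ℝ} (hε : 0 < ε) :
    Summable fun n : ℕ => θ n * Real.exp (-(ε ^ 2) / (2 * θ n ^ 2)) := by
  refine Summable.of_norm_bounded_eventually_nat (g := fun n : ℕ => ε / 2 * (1 / (n : ℝ) ^ 2))
    ((Real.summable_one_div_nat_pow.2 (by norm_num)).mul_left _) ?_
  filter_upwards [h.eventually_le_const (by positivity : 0 < ε ^ 2 / 4),
    eventually_ge_atTop 3] with n hn h3
  have hn3 : (3 : ℝ) ≤ n := by exact_mod_cast h3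
  have hlog : 1 ≤ Real.log n := by
    rw [Real.le_log_iff_exp_le (by linarith)]
    linarith [Real.exp_one_lt_three]
  rw [Real.norm_of_nonneg (mul_nonneg (hθ n) (Real.exp_nonneg _))]
  rcases (hθ n).eq_or_lt with h0 | h0
  · rw [← h0, zero_mul]; positivity
  have hle : θ n ≤ ε / 2 := by
    refine (pow_le_pow_iff_left₀ h0.le (by positivity) two_ne_zero).1 ?_
    nlinarith [sq_nonneg (θ n)]
  refine mul_le_mul hle ?_ (Real.exp_nonneg _) (by positivity)
  have hexp : 1 / (n : ℝ) ^ 2 = Real.exp (-(2 * Real.log n)) := by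
    rw [Real.exp_neg, two_mul, Real.exp_add, Real.exp_log (by linarith), one_div, sq]
  rw [hexp, Real.exp_le_exp, neg_div, neg_le_neg_iff, le_div_iff₀ (by positivity)]
  linarith

/-- The statements `Σ²(t) → 0` (real `t`), `Σ²(n) → 0` (integer `n`) and
`θ(n)²·log n → 0` are equivalent, and each implies `S'(ε) < ∞` for all `ε > 0`. -/
theorem stmt_5 (σ : ℝ → ℝ) (hσ : ContinuousOn σ (Set.Ici 0)) :
    (Filter.Tendsto (fun t : ℝ => Sig2 σ t) Filter.atTop (nhds 0) ↔
      Filter.Tendsto (fun n : ℕ => Sig2 σ n) Filter.atTop (nhds 0)) ∧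
    (Filter.Tendsto (fun n : ℕ => Sig2 σ n) Filter.atTop (nhds 0) ↔
      Filter.Tendsto (fun n : ℕ => (theta σ n) ^ 2 * Real.log n) Filter.atTop (nhds 0)) ∧
    (Filter.Tendsto (fun t : ℝ => Sig2 σ t) Filter.atTop (nhds 0) →
      ∀ ε : ℝ, 0 < ε → Summable (fun n : ℕ =>
        theta σ n * Real.exp (-(ε ^ 2) / (2 * (theta σ n) ^ 2)))) := by
  refine ⟨⟨fun h => h.comp tendsto_natCast_atTop_atTop, tendsto_Sig2_of_nat hσ⟩,
    ⟨tendsto_theta_sq_mul_log hσ, tendsto_Sig2_nat_of_theta hσ⟩, fun h ε hε => ?_⟩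
  exact summable_mul_exp_of_tendsto (fun n => Real.sqrt_nonneg _)
    (tendsto_theta_sq_mul_log hσ (h.comp tendsto_natCast_atTop_atTop)) hε
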